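/- Under property (A), for every t ∈ [0,1]: {k : t ∈ [a_k,c_k]} = {k : φ_{g,s}(t) ∈ [a'_k,c'_k]}. -/

import Mathlib

open MeasureTheory Set

noncomputable section

/-- `x` is not a one-sided minimum of `g`. -/
def NotOneSidedMin (g : ℝ → ℝ) (x : ℝ) : Prop :=
  x ∈ Set.Ioo (0:ℝ) 1 ∧ ∀ ε > 0, (∃ x₁ ∈ Set.Ioo (x-ε) x, g x₁ < g x) ∧
    (∃ x₂ ∈ Set.Ioo x (x+ε), g x₂ < g x)

/-- `b` is an inner local minimum of `g`. -/
def IsInnerLocalMin (g : ℝ → ℝ) (b : ℝ) : Prop :=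
  b ∈ Set.Ioo (0:ℝ) 1 ∧ ∃ ε > 0, ∀ x ∈ Set.Ioo (b-ε) (b+ε), g b ≤ g x

/-- `b` is a strict (inner) local minimum of `g`. -/
def IsStrictLocalMin (g : ℝ → ℝ) (b : ℝ) : Prop :=
  b ∈ Set.Ioo (0:ℝ) 1 ∧ ∃ ε > 0, ∀ x ∈ Set.Ioo (b-ε) (b+ε), x ≠ b → g b < g x

/-- A CRT excursion. -/
structure IsCRT (g : ℝ → ℝ) : Prop where
  cont : ContinuousOn g (Set.Icc 0 1)
  nonneg : ∀ t ∈ Set.Icc (0:ℝ) 1, 0 ≤ g t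
  pos : ∀ t ∈ Set.Ioo (0:ℝ) 1, 0 < g t
  zero0 : g 0 = 0
  zero1 : g 1 = 0
  dense_min : ∀ x ∈ Set.Icc (0:ℝ) 1, x ∈ closure {b | IsInnerLocalMin g b}
  distinct : ∀ b b', IsInnerLocalMin g b → IsInnerLocalMin g b' → g b = g b' → b = b'
  leaves_full : volume {x | NotOneSidedMin g x} = 1

/-- `β` is the unique minimum point of `g` on `[x,y]`, lies in `(x,y)`,
and is a strict local minimum: the most recent common ancestor of `x < y`. -/
def IsMrca (g : ℝ → ℝ) (β x y : ℝ) : Prop :=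
  x < y ∧ β ∈ Set.Ioo x y ∧ IsStrictLocalMin g β ∧
    (∀ t ∈ Set.Icc x y, g β ≤ g t) ∧ (∀ t ∈ Set.Icc x y, g t = g β → t = β)

/-- `x` and `y` are `g`-comparable. -/
def GComparable (g : ℝ → ℝ) (x y : ℝ) : Prop :=
  ∃ β, IsMrca g β (min x y) (max x y)

/-- `b` enumerates (injectively) the strict local minima of `g`. -/
def IsEnum (g : ℝ → ℝ) (b : ℕ → ℝ) : Prop :=
  Function.Injective b ∧ ∀ β, IsStrictLocalMin g β ↔ ∃ i, b i = β

/-- The sign-shuffled comparison relation `u ⊲ v` : if the mrca of `u,v` carries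
sign `⊕` (`true`) then the smaller goes first, otherwise the bigger goes first. -/
def Tri (g : ℝ → ℝ) (b : ℕ → ℝ) (s : ℕ → Bool) (u v : ℝ) : Prop :=
  ∃ i, (IsMrca g (b i) u v ∧ s i = true) ∨ (IsMrca g (b i) v u ∧ s i = false)

/-- The measure-preserving function `φ_{g,s}`. -/
def phi (g : ℝ → ℝ) (b : ℕ → ℝ) (s : ℕ → Bool) (t : ℝ) : ℝ :=
  (volume {u ∈ Set.Icc (0:ℝ) 1 | Tri g b s u t}).toReal

def aPt (g : ℝ → ℝ) (β : ℝ) : ℝ := sSup {t | t < β ∧ g t = g β}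
def cPt (g : ℝ → ℝ) (β : ℝ) : ℝ := sInf {t | β < t ∧ g t = g β}

def aI (g : ℝ → ℝ) (b : ℕ → ℝ) (i : ℕ) : ℝ := aPt g (b i)
def cI (g : ℝ → ℝ) (b : ℕ → ℝ) (i : ℕ) : ℝ := cPt g (b i)
def aI' (g : ℝ → ℝ) (b : ℕ → ℝ) (s : ℕ → Bool) (i : ℕ) : ℝ := phi g b s (aI g b i)
def cI' (g : ℝ → ℝ) (b : ℕ → ℝ) (s : ℕ → Bool) (i : ℕ) : ℝ :=
  aI' g b s i + (cI g b i - aI g b i)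
def bI' (g : ℝ → ℝ) (b : ℕ → ℝ) (s : ℕ → Bool) (i : ℕ) : ℝ :=
  aI' g b s i + (if s i then b i - aI g b i else cI g b i - b i)

/-- The permuton `μ_{g,s} = (Id, φ_{g,s})_* Leb`. -/
def permuton (g : ℝ → ℝ) (b : ℕ → ℝ) (s : ℕ → Bool) : Measure (ℝ × ℝ) :=
  Measure.map (fun t => (t, phi g b s t)) (volume.restrict (Set.Icc 0 1))

/-- Property (A) of a signed excursion. -/
def PropA (g : ℝ → ℝ) (b : ℕ → ℝ) (s : ℕ → Bool) : Prop :=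
  ∀ i j, i ≠ j →
    Set.Icc (aI' g b s j) (cI' g b s j) ⊆ Set.Icc (aI' g b s i) (cI' g b s i) →
    (∀ y ∈ Set.Icc (g (b i)) (g (b j)),
      y ∈ closure {h | ∃ l, h = g (b l) ∧
        Set.Icc (aI' g b s l) (cI' g b s l) ⊆ Set.Icc (aI' g b s i) (cI' g b s i) ∧
        Set.Icc (aI' g b s j) (cI' g b s j) ⊆ Set.Icc (bI' g b s l) (cI' g b s l)}) ∧
    (∀ y ∈ Set.Icc (g (b i)) (g (b j)),
      y ∈ closure {h | ∃ l, h = g (b l) ∧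
        Set.Icc (aI' g b s l) (cI' g b s l) ⊆ Set.Icc (aI' g b s i) (cI' g b s i) ∧
        Set.Icc (aI' g b s j) (cI' g b s j) ⊆ Set.Icc (aI' g b s l) (bI' g b s l)})

/-- The shuffled excursion `f_{g,s}`. -/
def fShuffle (g : ℝ → ℝ) (b : ℕ → ℝ) (s : ℕ → Bool) (t : ℝ) : ℝ :=
  ⨆ i, Set.indicator (Set.Icc (aI' g b s i) (cI' g b s i)) (fun _ => g (b i)) t

/-- Topological support of a measure. -/
def mSupport {α : Type*} [TopologicalSpace α] [MeasurableSpace α] (μ : Measure α) : Set α :=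
  {x | ∀ U : Set α, IsOpen U → x ∈ U → μ U ≠ 0}

lemma isMrca_iff {g : ℝ → ℝ} {m x y : ℝ} :
    IsMrca g m x y ↔ x < m ∧ m < y ∧ IsStrictLocalMin g m ∧
      ∀ z, x ≤ z → z ≤ y → z ≠ m → g m < g z := by
  constructor
  · rintro ⟨-, ⟨h1, h2⟩, h3, h4, h5⟩
    exact ⟨h1, h2, h3, fun z hz hz' hne =>
      lt_of_le_of_ne (h4 z ⟨hz, hz'⟩) fun h => hne (h5 z ⟨hz, hz'⟩ h.symm)⟩
  · rintro ⟨h1, h2, h3, h4⟩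
    refine ⟨h1.trans h2, ⟨h1, h2⟩, h3, fun z hz => ?_, fun z hz he => ?_⟩
    · rcases eq_or_ne z m with rfl | h
      · exact le_rfl
      · exact (h4 z hz.1 hz.2 h).le
    · by_contra h
      exact (h4 z hz.1 hz.2 h).ne' he

lemma IsStrictLocalMin.isInnerLocalMin {g : ℝ → ℝ} {m : ℝ} (h : IsStrictLocalMin g m) :
    IsInnerLocalMin g m := by
  obtain ⟨h0, ε, hε, h⟩ := h
  refine ⟨h0, ε, hε, fun x hx => ?_⟩
  rcases eq_or_ne x m with rfl | hne
  · exact le_rfl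
  · exact (h x hx hne).le

lemma IsCRT.isStrictLocalMin {g : ℝ → ℝ} (hg : IsCRT g) {m : ℝ} (h : IsInnerLocalMin g m) :
    IsStrictLocalMin g m := by
  obtain ⟨h0, ε, hε, hm⟩ := id h
  refine ⟨h0, min ε (min m (1 - m)),
    lt_min hε (lt_min h0.1 (by linarith [h0.2])), fun x hx hne => ?_⟩
  have l1 := min_le_left ε (min m (1 - m))
  have l2 := min_le_right ε (min m (1 - m))
  have l3 := min_le_left m (1 - m)
  have l4 := min_le_right m (1 - m)
  have hxε : x ∈ Ioo (m - ε) (m + ε) := ⟨by linarith [hx.1], by linarith [hx.2]⟩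
  refine lt_of_le_of_ne (hm x hxε) fun he => hne (hg.distinct x m ?_ h he.symm)
  refine ⟨⟨by linarith [hx.1], by linarith [hx.2]⟩, min (x - (m - ε)) (m + ε - x),
    lt_min (by linarith [hxε.1]) (by linarith [hxε.2]), fun y hy => ?_⟩
  have l5 := min_le_left (x - (m - ε)) (m + ε - x)
  have l6 := min_le_right (x - (m - ε)) (m + ε - x)
  rw [← he]
  exact hm y ⟨by linarith [hy.1], by linarith [hy.2]⟩

lemma isInnerLocalMin_of_forall_le {g : ℝ → ℝ} {m x y : ℝ} (hx : 0 ≤ x) (hy : y ≤ 1)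
    (hxm : x < m) (hmy : m < y) (h : ∀ z, x ≤ z → z ≤ y → g m ≤ g z) :
    IsInnerLocalMin g m := by
  refine ⟨⟨by linarith, by linarith⟩, min (m - x) (y - m),
    lt_min (by linarith) (by linarith), fun z hz => ?_⟩
  have l1 := min_le_left (m - x) (y - m)
  have l2 := min_le_right (m - x) (y - m)
  exact h z (by linarith [hz.1]) (by linarith [hz.2])

/-- The time reversal of a function on the unit interval. -/
def reversal (g : ℝ → ℝ) (x : ℝ) : ℝ := g (1 - x)

lemma reversal_reversal (g : ℝ → ℝ) : reversal (reversal g) = g := by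
  ext x; simp [reversal]

lemma IsInnerLocalMin.reversal {g : ℝ → ℝ} {m : ℝ} (h : IsInnerLocalMin g m) :
    IsInnerLocalMin (reversal g) (1 - m) := by
  obtain ⟨h0, ε, hε, h⟩ := h
  refine ⟨⟨by linarith [h0.2], by linarith [h0.1]⟩, ε, hε, fun x hx => ?_⟩
  simp only [_root_.reversal, sub_sub_cancel]
  exact h _ ⟨by linarith [hx.2], by linarith [hx.1]⟩

lemma IsStrictLocalMin.reversal {g : ℝ → ℝ} {m : ℝ} (h : IsStrictLocalMin g m) :
    IsStrictLocalMin (reversal g) (1 - m) := by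
  obtain ⟨h0, ε, hε, h⟩ := h
  refine ⟨⟨by linarith [h0.2], by linarith [h0.1]⟩, ε, hε, fun x hx hne => ?_⟩
  simp only [_root_.reversal, sub_sub_cancel]
  exact h _ ⟨by linarith [hx.2], by linarith [hx.1]⟩ fun h => hne (by linarith)

lemma IsMrca.reversal {g : ℝ → ℝ} {m x y : ℝ} (h : IsMrca g m x y) :
    IsMrca (reversal g) (1 - m) (1 - y) (1 - x) := by
  rw [isMrca_iff] at h ⊢
  obtain ⟨h1, h2, h3, h4⟩ := h
  refine ⟨by linarith, by linarith, h3.reversal, fun z hz hz' hne => ?_⟩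
  simp only [_root_.reversal, sub_sub_cancel]
  exact h4 _ (by linarith) (by linarith) fun h => hne (by linarith)

lemma NotOneSidedMin.reversal {g : ℝ → ℝ} {x : ℝ} (h : NotOneSidedMin g x) :
    NotOneSidedMin (reversal g) (1 - x) := by
  refine ⟨⟨by linarith [h.1.2], by linarith [h.1.1]⟩, fun ε hε => ?_⟩
  obtain ⟨⟨y, hy, hy'⟩, z, hz, hz'⟩ := h.2 ε hε
  refine ⟨⟨1 - z, ⟨by linarith [hz.2], by linarith [hz.1]⟩, ?_⟩,
    1 - y, ⟨by linarith [hy.2], by linarith [hy.1]⟩, ?_⟩ <;>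
  simpa [_root_.reversal]

lemma volume_preimage_one_sub (A : Set ℝ) :
    volume ((fun x : ℝ => 1 - x) ⁻¹' A) = volume A :=
  (Measure.measurePreserving_sub_left volume (1 : ℝ)).measure_preimage_emb
    (MeasurableEquiv.subLeft (1 : ℝ)).measurableEmbedding A

lemma IsCRT.reversal {g : ℝ → ℝ} (hg : IsCRT g) : IsCRT (reversal g) where
  cont := hg.cont.comp (by fun_prop) fun x hx => ⟨by linarith [hx.2], by linarith [hx.1]⟩
  nonneg t ht := hg.nonneg _ ⟨by linarith [ht.2], by linarith [ht.1]⟩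
  pos t ht := hg.pos _ ⟨by linarith [ht.2], by linarith [ht.1]⟩
  zero0 := by simpa [_root_.reversal] using hg.zero1
  zero1 := by simpa [_root_.reversal] using hg.zero0
  dense_min x hx := by
    have h := hg.dense_min (1 - x) ⟨by linarith [hx.2], by linarith [hx.1]⟩
    rw [Metric.mem_closure_iff] at h ⊢
    intro ε hε
    obtain ⟨m, hm, hd⟩ := h ε hε
    refine ⟨1 - m, hm.reversal, ?_⟩
    rw [Real.dist_eq] at hd ⊢
    rwa [← abs_neg, show -(x - (1 - m)) = 1 - x - m by ring]
  distinct m m' hm hm' he := by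
    have h1 := hm.reversal
    have h2 := hm'.reversal
    rw [reversal_reversal] at h1 h2
    have := hg.distinct _ _ h1 h2 he
    linarith
  leaves_full := by
    rw [← hg.leaves_full, ← volume_preimage_one_sub {x | NotOneSidedMin g x}]
    congr 1
    ext x
    refine ⟨fun h => ?_, fun h => ?_⟩
    · have := NotOneSidedMin.reversal h
      rwa [reversal_reversal] at this
    · have := NotOneSidedMin.reversal h
      rwa [sub_sub_cancel] at this

lemma IsEnum.reversal {g : ℝ → ℝ} {b : ℕ → ℝ} (hb : IsEnum g b) :
    IsEnum (reversal g) (fun i => 1 - b i) := by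
  refine ⟨fun i j h => hb.1 (by simpa using h), fun m => ⟨fun h => ?_, ?_⟩⟩
  · have h' := h.reversal
    rw [reversal_reversal] at h'
    obtain ⟨i, hi⟩ := (hb.2 _).1 h'
    exact ⟨i, by simp [hi]⟩
  · rintro ⟨i, rfl⟩
    exact ((hb.2 _).2 ⟨i, rfl⟩).reversal

lemma Tri.reversal {g : ℝ → ℝ} {b : ℕ → ℝ} {s : ℕ → Bool} {u v : ℝ} (h : Tri g b s u v) :
    Tri (reversal g) (fun i => 1 - b i) (fun i => !s i) (1 - u) (1 - v) := by
  obtain ⟨i, ⟨h, hs⟩ | ⟨h, hs⟩⟩ := h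
  · exact ⟨i, Or.inr ⟨h.reversal, by simp [hs]⟩⟩
  · exact ⟨i, Or.inl ⟨h.reversal, by simp [hs]⟩⟩

lemma Tri.of_reversal {g : ℝ → ℝ} {b : ℕ → ℝ} {s : ℕ → Bool} {u v : ℝ}
    (h : Tri (_root_.reversal g) (fun i => 1 - b i) (fun i => !s i) (1 - u) (1 - v)) :
    Tri g b s u v := by
  simpa [reversal_reversal] using h.reversal

lemma phi_reversal (g : ℝ → ℝ) (b : ℕ → ℝ) (s : ℕ → Bool) (t : ℝ) :
    phi (reversal g) (fun i => 1 - b i) (fun i => !s i) (1 - t) = phi g b s t := by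
  unfold phi
  rw [← volume_preimage_one_sub]
  congr 2
  ext u
  simp only [mem_preimage, mem_ofPred_eq, mem_Icc]
  refine ⟨fun h => ⟨⟨by linarith [h.1.2], by linarith [h.1.1]⟩, h.2.of_reversal⟩,
    fun h => ⟨⟨by linarith [h.1.2], by linarith [h.1.1]⟩, h.2.reversal⟩⟩

/-- `a` is the last time before `β` at which `g` takes the value `g β`, and `g` goes strictly
below that value immediately to the left of `a`. -/
structure IsLeftEnd (g : ℝ → ℝ) (a β : ℝ) : Prop where
  pos : 0 < a
  lt : a < β
  eq : g a = g β
  le : ∀ x, a ≤ x → x ≤ β → g β ≤ g x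
  exists_lt : ∀ y < a, ∃ x, y < x ∧ x < a ∧ g x < g β

lemma IsCRT.exists_isLeftEnd {g : ℝ → ℝ} (hg : IsCRT g) {β : ℝ} (hβ : IsStrictLocalMin g β) :
    ∃ a, IsGreatest {t | t < β ∧ g t = g β} a ∧ IsLeftEnd g a β := by
  obtain ⟨⟨h0, h1⟩, ε, hε, hm⟩ := id hβ
  obtain ⟨d, hd0, hdβ, hd⟩ : ∃ d, 0 < d ∧ d < β ∧ ∀ x, d ≤ x → x < β → g β < g x := by
    refine ⟨β - min (ε / 2) (β / 2), ?_, ?_, fun x hx hx' => ?_⟩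
    · linarith [min_le_right (ε / 2) (β / 2)]
    · linarith [lt_min (half_pos hε) (half_pos h0)]
    · exact hm x ⟨by linarith [min_le_left (ε / 2) (β / 2)], by linarith⟩ hx'.ne
  have ivt : ∀ x, 0 ≤ x → x ≤ d → g x < g β → ∃ z, x ≤ z ∧ z ≤ d ∧ g z = g β := by
    intro x hx hxd hgx
    have hc : ContinuousOn g (Icc x d) :=
      hg.cont.mono (Icc_subset_Icc hx (by linarith))
    obtain ⟨z, hz, hz'⟩ := intermediate_value_Icc hxd hc
      ⟨hgx.le, (hd d le_rfl hdβ).le⟩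
    exact ⟨z, hz.1, hz.2, hz'⟩
  have hgβ : 0 < g β := hg.pos β ⟨h0, h1⟩
  have hK : IsCompact (Icc 0 d ∩ g ⁻¹' {g β}) :=
    isCompact_Icc.of_isClosed_subset
      ((hg.cont.mono (Icc_subset_Icc le_rfl (by linarith))).preimage_isClosed_of_isClosed
        isClosed_Icc isClosed_singleton) inter_subset_left
  obtain ⟨a, ⟨⟨ha0, had⟩, hga⟩, hamax⟩ := hK.exists_isGreatest (by
    obtain ⟨z, hz, hz', hz''⟩ := ivt 0 le_rfl hd0.le (by rw [hg.zero0]; exact hgβ)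
    exact ⟨z, ⟨hz, hz'⟩, hz''⟩)
  have hga : g a = g β := hga
  have hmax : ∀ t, t < β → g t = g β → t ≤ a := by
    intro t ht hgt
    rcases lt_or_ge t 0 with h | h
    · linarith
    · rcases le_or_gt d t with h' | h'
      · exact absurd hgt (hd t h' ht).ne'
      · exact hamax ⟨⟨h, h'.le⟩, hgt⟩
  have hapos : 0 < a := lt_of_le_of_ne ha0 fun h => by
    rw [← h, hg.zero0] at hga; linarith
  have hle : ∀ x, a ≤ x → x ≤ β → g β ≤ g x := by
    intro x hx hx'
    by_contra! hlt
    have hxd : x < d := by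
      by_contra! h
      rcases hx'.lt_or_eq with h' | h'
      · linarith [hd x h h']
      · rw [h'] at hlt; exact lt_irrefl _ hlt
    obtain ⟨z, hz, hz', hz''⟩ := ivt x (by linarith) hxd.le hlt
    have hza := hmax z (by linarith) hz''
    have : x = z := by linarith
    rw [this] at hlt; linarith
  refine ⟨a, ⟨⟨by linarith, hga⟩, fun t ht => hmax t ht.1 ht.2⟩, hapos, by linarith, hga, hle, ?_⟩
  intro y hy
  by_contra! hno
  have : IsInnerLocalMin g a := by
    refine isInnerLocalMin_of_forall_le (x := (max y 0 + a) / 2) (y := β) ?_ h1.le ?_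
      (by linarith) ?_
    · linarith [le_max_right y 0]
    · linarith [max_lt hy hapos]
    · intro z hz hz'
      rw [hga]
      rcases lt_or_ge z a with h | h
      · have := max_lt hy hapos
        exact hno z (by linarith [le_max_left y 0]) h
      · exact hle z h hz'
  have := hg.distinct _ _ this hβ.isInnerLocalMin hga
  linarith

/-- The interval `[a, c]` is the excursion interval of `g` above the value `g β`, around `β`. -/
structure IsBranch (g : ℝ → ℝ) (a β c : ℝ) : Prop where
  left : IsLeftEnd g a β
  right : IsLeftEnd (reversal g) (1 - c) (1 - β)

namespace IsBranch

variable {g : ℝ → ℝ} {a β c : ℝ}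

lemma reversal (h : IsBranch g a β c) : IsBranch (reversal g) (1 - c) (1 - β) (1 - a) :=
  ⟨h.right, by simpa [reversal_reversal] using h.left⟩

lemma lt_right (h : IsBranch g a β c) : β < c := by linarith [h.right.lt]

lemma lt (h : IsBranch g a β c) : a < c := h.left.lt.trans h.lt_right

lemma lt_one (h : IsBranch g a β c) : c < 1 := by linarith [h.right.pos]

lemma eq_right (h : IsBranch g a β c) : g c = g β := by
  simpa [_root_.reversal] using h.right.eq

lemma le (h : IsBranch g a β c) {x : ℝ} (hx : x ∈ Icc a c) : g β ≤ g x := by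
  rcases le_total x β with h' | h'
  · exact h.left.le x hx.1 h'
  · simpa [_root_.reversal] using h.right.le (1 - x) (by linarith [hx.2]) (by linarith)

lemma exists_lt_right (h : IsBranch g a β c) {y : ℝ} (hy : c < y) :
    ∃ x, c < x ∧ x < y ∧ g x < g β := by
  obtain ⟨x, h1, h3, h4⟩ := h.right.exists_lt (1 - y) (by linarith)
  exact ⟨1 - x, by linarith, by linarith, by simpa [_root_.reversal] using h4⟩

lemma isMrca_of_lt (h : IsBranch g a β c) {u x y m : ℝ} (hu : u < a) (hx : x ∈ Icc a c)
    (hy : y ∈ Icc a c) (hm : IsMrca g m u x) : IsMrca g m u y := by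
  rw [isMrca_iff] at hm ⊢
  obtain ⟨h1, h2, h3, h4⟩ := hm
  obtain ⟨z, hz1, hz3, hz4⟩ := h.left.exists_lt u hu
  have hmβ : g m < g β := by
    rcases eq_or_ne z m with rfl | hne
    · exact hz4
    · exact (h4 z hz1.le (by linarith [hx.1]) hne).trans hz4
  have hma : m < a := by
    by_contra! hle
    linarith [h.le (x := m) ⟨hle, by linarith [hx.2]⟩]
  refine ⟨h1, by linarith [hy.1], h3, fun w hw hw' hne => ?_⟩
  rcases le_or_gt w x with hwx | hwx
  · exact h4 w hw hwx hne
  · exact hmβ.trans_le (h.le ⟨by linarith [hx.1], by linarith [hy.2]⟩)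

lemma tri_of_notMem (h : IsBranch g a β c) {b : ℕ → ℝ} {s : ℕ → Bool} {u x y : ℝ}
    (hu : u ∉ Icc a c) (hx : x ∈ Icc a c) (hy : y ∈ Icc a c) (hT : Tri g b s u x) :
    Tri g b s u y := by
  rcases lt_or_ge u a with hua | hua
  · obtain ⟨i, ⟨hm, hs⟩ | ⟨hm, hs⟩⟩ := hT
    · exact ⟨i, Or.inl ⟨h.isMrca_of_lt hua hx hy hm, hs⟩⟩
    · linarith [hm.1, hx.1]
  · have huc : c < u := by
      by_contra! h'
      exact hu ⟨hua, h'⟩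
    obtain ⟨i, ⟨hm, hs⟩ | ⟨hm, hs⟩⟩ := hT
    · linarith [hm.1, hx.2]
    · have := (h.reversal.isMrca_of_lt (y := 1 - y) (by linarith)
        ⟨by linarith [hx.2], by linarith [hx.1]⟩ ⟨by linarith [hy.2], by linarith [hy.1]⟩
        hm.reversal).reversal
      simp only [reversal_reversal, sub_sub_cancel] at this
      exact ⟨i, Or.inr ⟨this, hs⟩⟩

lemma not_tri (h : IsBranch g a β c) {b : ℕ → ℝ} {s : ℕ → Bool} {u : ℝ} (hu : u ∈ Icc a c) :
    ¬ Tri g b s u a := by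
  rintro ⟨i, ⟨hm, -⟩ | ⟨hm, -⟩⟩
  · linarith [hm.1, hu.1]
  · rw [isMrca_iff] at hm
    obtain ⟨h1, h2, -, h4⟩ := hm
    have := h4 a le_rfl hu.1 h1.ne
    linarith [h.le (x := b i) ⟨h1.le, by linarith [hu.2]⟩, h.left.eq]

end IsBranch

lemma IsCRT.isBranch {g : ℝ → ℝ} (hg : IsCRT g) {β : ℝ} (hβ : IsStrictLocalMin g β) :
    IsBranch g (aPt g β) β (cPt g β) := by
  obtain ⟨a, ha, ha'⟩ := hg.exists_isLeftEnd hβ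
  obtain ⟨d, hd, hd'⟩ := hg.reversal.exists_isLeftEnd hβ.reversal
  have hc : IsLeast {t | β < t ∧ g t = g β} (1 - d) := by
    refine ⟨⟨by linarith [hd.1.1], by simpa [_root_.reversal] using hd.1.2⟩, fun t ht => ?_⟩
    have : 1 - t ≤ d := hd.2 ⟨by linarith [ht.1], by simpa [_root_.reversal] using ht.2⟩
    linarith
  rw [aPt, cPt, ha.csSup_eq, hc.csInf_eq]
  exact ⟨ha', by rwa [sub_sub_cancel]⟩

lemma Tri.trans_of_isMrca {g : ℝ → ℝ} (hg : IsCRT g) {b : ℕ → ℝ} {s : ℕ → Bool} {u x y : ℝ}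
    {j : ℕ} (hb : Function.Injective b) (hu : Tri g b s u x) (hm : IsMrca g (b j) x y)
    (hs : s j = true) :
    Tri g b s u y := by
  rw [isMrca_iff] at hm
  obtain ⟨h1, h2, h3, h4⟩ := hm
  obtain ⟨i, ⟨hm, hi⟩ | ⟨hm, hi⟩⟩ := hu
  · rw [isMrca_iff] at hm
    obtain ⟨k1, k2, k3, k4⟩ := hm
    rcases lt_trichotomy (g (b i)) (g (b j)) with h | h | h
    · refine ⟨i, Or.inl ⟨isMrca_iff.2 ⟨k1, by linarith, k3, fun z hz hz' hne => ?_⟩, hi⟩⟩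
      rcases le_total z x with hzx | hzx
      · exact k4 z hz hzx hne
      · rcases eq_or_ne z (b j) with rfl | hzj
        · exact h
        · exact h.trans (h4 z hzx hz' hzj)
    · have := hg.distinct _ _ k3.isInnerLocalMin h3.isInnerLocalMin h
      linarith
    · refine ⟨j, Or.inl ⟨isMrca_iff.2 ⟨by linarith, h2, h3, fun z hz hz' hne => ?_⟩, hs⟩⟩
      rcases le_total x z with hzx | hzx
      · exact h4 z hzx hz' hne
      · rcases eq_or_ne z (b i) with rfl | hzi
        · exact h
        · exact h.trans (k4 z hz hzx hzi)
  · rw [isMrca_iff] at hm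
    obtain ⟨k1, k2, k3, k4⟩ := hm
    have hij : b i ≠ b j ∧ g (b i) ≠ g (b j) := by
      have hij : g (b i) ≠ g (b j) := fun h => by
        have hbij := hg.distinct _ _ k3.isInnerLocalMin h3.isInnerLocalMin h
        rw [hb hbij, hs] at hi
        exact Bool.noConfusion hi
      exact ⟨fun h => hij (by rw [h]), hij⟩
    rcases lt_or_gt_of_ne hij.2 with h | h
    · have hyi : y < b i := by
        by_contra! hle
        linarith [h4 (b i) k1.le hle hij.1]
      refine ⟨i, Or.inr ⟨isMrca_iff.2 ⟨hyi, k2, k3, fun z hz hz' hne => ?_⟩, hi⟩⟩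
      exact k4 z (by linarith) hz' hne
    · have huj : u < b j := by
        by_contra! hle
        linarith [k4 (b j) h1.le hle hij.1.symm]
      refine ⟨j, Or.inl ⟨isMrca_iff.2 ⟨huj, h2, h3, fun z hz hz' hne => ?_⟩, hs⟩⟩
      exact h4 z (by linarith) hz' hne

lemma Tri.trans {g : ℝ → ℝ} (hg : IsCRT g) {b : ℕ → ℝ} {s : ℕ → Bool} {u x y : ℝ}
    (hb : Function.Injective b) (hu : Tri g b s u x) (hx : Tri g b s x y) : Tri g b s u y := by
  obtain ⟨j, ⟨hm, hs⟩ | ⟨hm, hs⟩⟩ := hx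
  · exact hu.trans_of_isMrca hg hb hm hs
  · exact (hu.reversal.trans_of_isMrca hg.reversal (fun _ _ h => hb (by simpa using h))
      hm.reversal (by simp [hs])).of_reversal

lemma phi_add_le_phi_add {g : ℝ → ℝ} {b : ℕ → ℝ} {s : ℕ → Bool} {x y : ℝ} {S T : Set ℝ}
    (hS : MeasurableSet S) (hT : volume T ≠ ⊤) (hS01 : S ⊆ Icc 0 1)
    (hdisj : ∀ u ∈ S, ¬ Tri g b s u x) (hST : ∀ u ∈ S, Tri g b s u y ∨ u ∈ T)
    (hxy : ∀ u, Tri g b s u x → Tri g b s u y ∨ u ∈ T) :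
    phi g b s x + volume.real S ≤ phi g b s y + volume.real T := by
  have hfin : ∀ t, volume {u ∈ Icc (0:ℝ) 1 | Tri g b s u t} ≠ ⊤ := fun t =>
    measure_ne_top_of_subset (sep_subset _ _) isCompact_Icc.measure_ne_top
  calc phi g b s x + volume.real S
      = volume.real ({u ∈ Icc (0:ℝ) 1 | Tri g b s u x} ∪ S) :=
        (measureReal_union (disjoint_left.2 fun u hu huS => hdisj u huS hu.2) hS (hfin x)
          (measure_ne_top_of_subset hS01 isCompact_Icc.measure_ne_top)).symm
    _ ≤ volume.real ({u ∈ Icc (0:ℝ) 1 | Tri g b s u y} ∪ T) := by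
        refine measureReal_mono ?_ (measure_union_ne_top (hfin y) hT)
        rintro u (⟨hu, hux⟩ | hu)
        · exact (hxy u hux).imp_left fun h => ⟨hu, h⟩
        · exact (hST u hu).imp_left fun h => ⟨hS01 hu, h⟩
    _ ≤ phi g b s y + volume.real T := measureReal_union_le _ _

lemma phi_mono {g : ℝ → ℝ} {b : ℕ → ℝ} {s : ℕ → Bool} {x y : ℝ}
    (hxy : ∀ u, Tri g b s u x → Tri g b s u y) : phi g b s x ≤ phi g b s y := by
  simpa using phi_add_le_phi_add (S := ∅) (T := ∅) MeasurableSet.empty (by simp) (by simp)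
    (by simp) (by simp) (fun u hu => Or.inl (hxy u hu))

namespace IsBranch

variable {g : ℝ → ℝ} {a β c : ℝ} {b : ℕ → ℝ} {s : ℕ → Bool}

lemma subset_unit (h : IsBranch g a β c) : Icc a c ⊆ Icc 0 1 :=
  Icc_subset_Icc h.left.pos.le h.lt_one.le

lemma volume_real (h : IsBranch g a β c) : volume.real (Icc a c) = c - a := by
  rw [Real.volume_real_Icc_of_le h.lt.le]

lemma phi_left_le (h : IsBranch g a β c) {t : ℝ} (ht : t ∈ Icc a c) :
    phi g b s a ≤ phi g b s t :=
  phi_mono fun _ hu => h.tri_of_notMem (fun hu' => h.not_tri hu' hu) ⟨le_rfl, h.lt.le⟩ ht hu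

lemma phi_le (h : IsBranch g a β c) {t : ℝ} (ht : t ∈ Icc a c) :
    phi g b s t ≤ phi g b s a + (c - a) := by
  have := phi_add_le_phi_add (g := g) (b := b) (s := s) (x := t) (y := a) (S := ∅)
    (T := Icc a c) MeasurableSet.empty (by simp) (by simp) (by simp) (by simp) (fun u hu => by
      by_cases hu' : u ∈ Icc a c
      · exact Or.inr hu'
      · exact Or.inl (h.tri_of_notMem hu' ht ⟨le_rfl, h.lt.le⟩ hu))
  simpa [h.volume_real] using this

lemma phi_right (h : IsBranch g a β c) : phi g b s c = phi g b s a := by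
  refine le_antisymm ?_ (h.phi_left_le ⟨h.lt.le, le_rfl⟩)
  have := h.reversal.phi_left_le (b := fun i => 1 - b i) (s := fun i => !s i) (t := 1 - a)
    ⟨by linarith [h.lt], le_rfl⟩
  rwa [phi_reversal, phi_reversal] at this

lemma phi_add_le_of_subset {a' β' c' : ℝ} (h : IsBranch g a β c) (h' : IsBranch g a' β' c')
    (hsub : Icc a c ⊆ Icc a' c') :
    phi g b s a + (c - a) ≤ phi g b s a' + (c' - a') := by
  have := phi_add_le_phi_add (g := g) (b := b) (s := s) (x := a) (y := a') (S := Icc a c)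
    (T := Icc a' c') measurableSet_Icc (by simp) h.subset_unit (fun u hu => h.not_tri hu)
    (fun u hu => Or.inr (hsub hu)) (fun u hu => by
      by_cases hu' : u ∈ Icc a' c'
      · exact Or.inr hu'
      · exact Or.inl (h'.tri_of_notMem hu' (hsub ⟨le_rfl, h.lt.le⟩) ⟨le_rfl, h'.lt.le⟩ hu))
  rwa [h.volume_real, h'.volume_real] at this

end IsBranch

lemma IsCRT.exists_isMinOn {g : ℝ → ℝ} (hg : IsCRT g) {x y : ℝ} (hx : 0 ≤ x) (hxy : x ≤ y)
    (hy : y ≤ 1) : ∃ w ∈ Icc x y, (∀ z ∈ Icc x y, g w ≤ g z) ∧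
      ∀ z ∈ Icc x y, w < z → g w < g z := by
  have hc : ContinuousOn g (Icc x y) := hg.cont.mono (Icc_subset_Icc hx hy)
  obtain ⟨w₀, hw₀, hmin⟩ := isCompact_Icc.exists_isMinOn (nonempty_Icc.2 hxy) hc
  have hK : IsCompact (Icc x y ∩ g ⁻¹' {g w₀}) :=
    isCompact_Icc.of_isClosed_subset
      (hc.preimage_isClosed_of_isClosed isClosed_Icc isClosed_singleton) inter_subset_left
  obtain ⟨w, ⟨hw, hgw⟩, hmax⟩ := hK.exists_isGreatest ⟨w₀, hw₀, rfl⟩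
  have hgw : g w = g w₀ := hgw
  refine ⟨w, hw, fun z hz => hgw ▸ hmin hz, fun z hz hwz => ?_⟩
  refine lt_of_le_of_ne (hgw ▸ hmin hz) fun he => hwz.not_ge (hmax ⟨hz, ?_⟩)
  exact he.symm.trans hgw

namespace IsBranch

variable {g : ℝ → ℝ} {a β c t : ℝ} {b : ℕ → ℝ} {s : ℕ → Bool}

lemma phi_of_lt_left (h : IsBranch g a β c) (hg : IsCRT g) (hb : IsEnum g b)
    (ht0 : 0 ≤ t) (hta : t < a) :
    phi g b s t ≤ phi g b s a ∨ phi g b s a + (c - a) ≤ phi g b s t := by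
  have ha1 : a ≤ 1 := (h.lt.trans h.lt_one).le
  obtain ⟨w, hw, hmin, -⟩ := hg.exists_isMinOn ht0 hta.le ha1
  have hwa : g w < g a := by
    obtain ⟨z, h1, h3, h4⟩ := h.left.exists_lt t hta
    linarith [hmin z ⟨h1.le, h3.le⟩, h.left.eq]
  by_cases hgt : g t = g w
  · refine Or.inl (phi_mono fun u hu => ?_)
    obtain ⟨i, ⟨hm, hi⟩ | ⟨hm, hi⟩⟩ := hu
    · rw [isMrca_iff] at hm
      obtain ⟨k1, k2, k3, k4⟩ := hm
      have := k4 t (by linarith) le_rfl k2.ne'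
      refine ⟨i, Or.inl ⟨isMrca_iff.2 ⟨k1, by linarith, k3, fun z hz hz' hne => ?_⟩, hi⟩⟩
      rcases le_total z t with hzt | hzt
      · exact k4 z hz hzt hne
      · linarith [hmin z ⟨hzt, hz'⟩]
    · rw [isMrca_iff] at hm
      obtain ⟨k1, k2, k3, k4⟩ := hm
      have := k4 t le_rfl (by linarith) k1.ne
      have hai : a < b i := by
        by_contra! hle
        linarith [hmin _ ⟨k1.le, hle⟩]
      exact ⟨i, Or.inr ⟨isMrca_iff.2
        ⟨hai, k2, k3, fun z hz hz' hne => k4 z (by linarith) hz' hne⟩, hi⟩⟩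
  · have inner : ∀ z ∈ Icc t a, g z = g w → IsInnerLocalMin g z := by
      intro z hz he
      refine isInnerLocalMin_of_forall_le ht0 ha1 (lt_of_le_of_ne hz.1 ?_)
        (lt_of_le_of_ne hz.2 ?_) fun y hy hy' => he ▸ hmin y ⟨hy, hy'⟩
      · rintro rfl; exact hgt he
      · rintro rfl; exact hwa.ne' he
    have hwin := inner w hw rfl
    obtain ⟨j, rfl⟩ := (hb.2 w).1 (hg.isStrictLocalMin hwin)
    have hm : IsMrca g (b j) t a := by
      refine isMrca_iff.2 ⟨lt_of_le_of_ne hw.1 fun e => hgt (by rw [e]),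
        lt_of_le_of_ne hw.2 fun e => hwa.ne (by rw [e]), hg.isStrictLocalMin hwin,
        fun z hz hz' hne => lt_of_le_of_ne (hmin z ⟨hz, hz'⟩) fun he => hne ?_⟩
      exact hg.distinct _ _ (inner z ⟨hz, hz'⟩ he.symm) hwin he.symm
    cases hs : s j
    · right
      have hT : ∀ u ∈ Icc a c, Tri g b s u t := fun u hu =>
        ⟨j, Or.inr ⟨h.isMrca_of_lt hta ⟨le_rfl, h.lt.le⟩ hu hm, hs⟩⟩
      have := phi_add_le_phi_add (g := g) (b := b) (s := s) (x := a) (y := t) (S := Icc a c)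
        (T := ∅) measurableSet_Icc (by simp) h.subset_unit (fun u hu => h.not_tri hu)
        (fun u hu => Or.inl (hT u hu))
        (fun u hu => Or.inl (hu.trans hg hb.1 (hT a ⟨le_rfl, h.lt.le⟩)))
      simpa [h.volume_real] using this
    · exact Or.inl (phi_mono fun u hu => hu.trans hg hb.1 ⟨j, Or.inl ⟨hm, hs⟩⟩)

lemma phi_of_notMem (h : IsBranch g a β c) (hg : IsCRT g) (hb : IsEnum g b)
    (ht : t ∈ Icc 0 1) (hta : t ∉ Icc a c) :
    phi g b s t ≤ phi g b s a ∨ phi g b s a + (c - a) ≤ phi g b s t := by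
  rcases lt_or_ge t a with h' | h'
  · exact h.phi_of_lt_left hg hb ht.1 h'
  · have hct : c < t := by
      by_contra! h''
      exact hta ⟨h', h''⟩
    have := h.reversal.phi_of_lt_left (s := fun i => !s i) hg.reversal hb.reversal
      (t := 1 - t) (by linarith [ht.2]) (by linarith)
    rwa [phi_reversal, phi_reversal, h.phi_right, show 1 - a - (1 - c) = c - a by ring] at this

lemma exists_isStrictLocalMin_of_lt_left (h : IsBranch g a β c) (hg : IsCRT g)
    (ht0 : 0 ≤ t) (hta : t < a) :
    ∃ m, IsStrictLocalMin g m ∧ ∀ a' c', IsBranch g a' m c' → t < a' ∧ a' < a ∧ c < c' := by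
  have ha1 : a < 1 := h.lt.trans h.lt_one
  obtain ⟨v, hv, hvmin, hvlast⟩ := hg.exists_isMinOn ht0 hta.le ha1.le
  have hva : g v < g a := by
    obtain ⟨z, h1, h3, h4⟩ := h.left.exists_lt t hta
    linarith [hvmin z ⟨h1.le, h3.le⟩, h.left.eq]
  have hva' : v < a := lt_of_le_of_ne hv.2 fun e => hva.ne (by rw [e])
  obtain ⟨d, hvd, hda, hd⟩ : ∃ d, v < d ∧ d ≤ a ∧ ∀ x, v ≤ x → x < d → g x < g a := by
    have hc := hg.cont v ⟨by linarith [hv.1], by linarith⟩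
    obtain ⟨δ, hδ, hball⟩ := Metric.mem_nhdsWithin_iff.1 (hc (Iio_mem_nhds hva))
    refine ⟨min a (v + δ), lt_min hva' (by linarith), min_le_left _ _, fun x hx hx' => ?_⟩
    have l1 := min_le_left a (v + δ)
    have l2 := min_le_right a (v + δ)
    refine hball ⟨?_, by linarith [hv.1], by linarith⟩
    rw [Metric.mem_ball, Real.dist_eq, abs_lt]
    constructor <;> linarith
  obtain ⟨p, hp, hvp, hpd⟩ : ∃ p, IsInnerLocalMin g p ∧ v < p ∧ p < d := by
    have hcl := hg.dense_min ((v + d) / 2) ⟨by linarith [hv.1], by linarith⟩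
    obtain ⟨p, hp, hp'⟩ := mem_closure_iff.1 hcl (Ioo v d) isOpen_Ioo
      ⟨by linarith, by linarith⟩
    exact ⟨p, hp', hp.1, hp.2⟩
  have hpa := hd p hvp.le hpd
  obtain ⟨m, hm, hmmin, -⟩ := hg.exists_isMinOn (x := p) (y := a) (by linarith [hp.1.1])
    (by linarith) ha1.le
  have hgm : g m < g a := (hmmin p ⟨le_rfl, by linarith⟩).trans_lt hpa
  have hma : m < a := lt_of_le_of_ne hm.2 fun e => hgm.ne (by rw [e])
  have hmin : IsInnerLocalMin g m := by
    rcases hm.1.eq_or_lt with e | hlt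
    · rwa [← e]
    · exact isInnerLocalMin_of_forall_le hp.1.1.le ha1.le hlt hma
        fun z hz hz' => hmmin z ⟨hz, hz'⟩
  have hvm : v < m := hvp.trans_le hm.1
  have hgvm : g v < g m := hvlast m ⟨by linarith [hv.1], hma.le⟩ hvm
  refine ⟨m, hg.isStrictLocalMin hmin, fun a' c' h' => ⟨?_, h'.left.lt.trans hma, ?_⟩⟩
  · by_contra! hle
    linarith [h'.left.le v (by linarith [hv.1]) hvm.le]
  · by_contra! hle
    have hc' := h'.eq_right
    have hmc := h'.lt_right
    rcases le_or_gt a c' with hac | hac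
    · linarith [h.le (x := c') ⟨hac, hle⟩, h.left.eq]
    · obtain ⟨x, h1, h2, h3⟩ := h'.exists_lt_right hac
      linarith [hmmin x ⟨by linarith [hm.1], h2.le⟩]

lemma exists_isStrictLocalMin_of_notMem (h : IsBranch g a β c) (hg : IsCRT g)
    (ht : t ∈ Icc 0 1) (hta : t ∉ Icc a c) :
    ∃ m, IsStrictLocalMin g m ∧
      ∀ a' c', IsBranch g a' m c' → t ∉ Icc a' c' ∧ a' < a ∧ c < c' := by
  rcases lt_or_ge t a with h' | h'
  · obtain ⟨m, hm, H⟩ := h.exists_isStrictLocalMin_of_lt_left hg ht.1 h'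
    exact ⟨m, hm, fun a' c' hm' => ⟨fun hmem => (H a' c' hm').1.not_ge hmem.1, (H a' c' hm').2⟩⟩
  · have hct : c < t := by
      by_contra! h''
      exact hta ⟨h', h''⟩
    obtain ⟨m, hm, H⟩ := h.reversal.exists_isStrictLocalMin_of_lt_left hg.reversal
      (t := 1 - t) (by linarith [ht.2]) (by linarith)
    refine ⟨1 - m, by simpa [reversal_reversal] using hm.reversal, fun a' c' hm' => ?_⟩
    have hr := hm'.reversal
    rw [sub_sub_cancel] at hr
    obtain ⟨h1, h2, h3⟩ := H _ _ hr
    exact ⟨fun hmem => by linarith [hmem.2], by linarith, by linarith⟩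

end IsBranch

lemma bI'_mem_Ioo {g : ℝ → ℝ} {b : ℕ → ℝ} {s : ℕ → Bool} {l : ℕ}
    (h : IsBranch g (aI g b l) (b l) (cI g b l)) :
    bI' g b s l ∈ Ioo (aI' g b s l) (cI' g b s l) := by
  have h1 := h.left.lt
  have h2 := h.lt_right
  unfold bI' cI'
  split_ifs <;> constructor <;> linarith

/-- Under property (A), strictly nested excursion intervals have shuffled images that share no
endpoint. -/
lemma PropA.strict_subset {g : ℝ → ℝ} (hg : IsCRT g) {b : ℕ → ℝ} (hb : IsEnum g b)
    {s : ℕ → Bool} (hA : PropA g b s) {k l : ℕ}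
    (ha : aI g b l < aI g b k) (hc : cI g b k < cI g b l) :
    aI' g b s l < aI' g b s k ∧ cI' g b s k < cI' g b s l := by
  have hbr : ∀ i, IsBranch g (aI g b i) (b i) (cI g b i) := fun i =>
    hg.isBranch ((hb.2 _).2 ⟨i, rfl⟩)
  have hac : ∀ i, aI' g b s i ≤ cI' g b s i := fun i => by
    have := (hbr i).lt
    unfold cI'
    linarith
  have hlk : g (b l) ≤ g (b k) := by
    rw [← (hbr k).left.eq]
    exact (hbr l).le ⟨ha.le, ((hbr k).lt.trans hc).le⟩
  have hsub : Icc (aI' g b s k) (cI' g b s k) ⊆ Icc (aI' g b s l) (cI' g b s l) :=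
    Icc_subset_Icc ((hbr l).phi_left_le ⟨ha.le, ((hbr k).lt.trans hc).le⟩)
      ((hbr k).phi_add_le_of_subset (hbr l) (Icc_subset_Icc ha.le hc.le))
  obtain ⟨H1, H2⟩ := hA l k (by rintro rfl; exact lt_irrefl _ ha) hsub
  constructor
  · obtain ⟨-, i, -, h1, h2⟩ := closure_nonempty_iff.1 ⟨_, H1 _ ⟨le_rfl, hlk⟩⟩
    have h1 := h1 ⟨le_rfl, hac i⟩
    have h2 := h2 ⟨le_rfl, hac k⟩
    have := bI'_mem_Ioo (s := s) (hbr i)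
    linarith [this.1, h1.1, h2.1]
  · obtain ⟨-, i, -, h1, h2⟩ := closure_nonempty_iff.1 ⟨_, H2 _ ⟨le_rfl, hlk⟩⟩
    have h1 := h1 ⟨hac i, le_rfl⟩
    have h2 := h2 ⟨hac k, le_rfl⟩
    have := bI'_mem_Ioo (s := s) (hbr i)
    linarith [this.2, h1.2, h2.2]

/-- Under property (A), `t` lies in `[a_k,c_k]` iff `φ(t)` lies in `[a'_k,c'_k]`. -/
theorem stmt17 (g : ℝ → ℝ) (hg : IsCRT g) (b : ℕ → ℝ) (hb : IsEnum g b) (s : ℕ → Bool)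
    (hA : PropA g b s) :
    ∀ t ∈ Set.Icc (0:ℝ) 1,
      {k | t ∈ Set.Icc (aI g b k) (cI g b k)} =
      {k | phi g b s t ∈ Set.Icc (aI' g b s k) (cI' g b s k)} := by
  intro t ht
  have hbr : ∀ i, IsBranch g (aI g b i) (b i) (cI g b i) := fun i =>
    hg.isBranch ((hb.2 _).2 ⟨i, rfl⟩)
  ext k
  refine ⟨fun h => ⟨(hbr k).phi_left_le h, (hbr k).phi_le h⟩, fun h => ?_⟩
  by_contra hk
  obtain ⟨m, hm, H⟩ := (hbr k).exists_isStrictLocalMin_of_notMem hg ht hk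
  obtain ⟨l, rfl⟩ := (hb.2 m).1 hm
  obtain ⟨h1, h2, h3⟩ := H _ _ (hbr l)
  obtain ⟨h4, h5⟩ := hA.strict_subset hg hb h2 h3
  rcases (hbr l).phi_of_notMem (s := s) hg hb ht h1 with h6 | h6
  · exact (h4.trans_le h.1).not_ge h6
  · exact (h.2.trans_lt h5).not_ge h6

end
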